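/- Let Z ~ N(0, I_p) and let A be a p×p positive definite matrix. Then E[⟨AZ, Z⟩⁴] ≤ (tr(A) + 3‖A‖₂)⁴. -/

import Mathlib

open MeasureTheory ProbabilityTheory Matrix

/-- The standard Gaussian measure `N(0, I_p)` on `ℝ^p`. -/
noncomputable def stdGaussian (p : ℕ) : Measure (Fin p → ℝ) :=
  Measure.pi fun _ => gaussianReal 0 1

/-- Spectral (ℓ₂-operator) norm of a real matrix. -/
noncomputable def specNorm {p : ℕ} (M : Matrix (Fin p) (Fin p) ℝ) : ℝ :=
  sSup {c | ∃ u v : Fin p → ℝ, (∑ i, (u i) ^ 2) = 1 ∧ (∑ i, (v i) ^ 2) = 1 ∧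
    c = |u ⬝ᵥ M.mulVec v|}


lemma gq_integrable_pow (n : ℕ) : Integrable (fun x : ℝ => x ^ n) (gaussianReal 0 1) := by
  have h := memLp_id_gaussianReal (μ := 0) (v := 1) n
  have := h.integrable_norm_pow'
  refine (integrable_norm_iff (by fun_prop)).1 ?_
  simpa using this

lemma gq_integrable_pow_pdf (n : ℕ) :
    Integrable (fun x : ℝ => gaussianPDFReal 0 1 x * x ^ n) := by
  have h := gq_integrable_pow n
  rw [gaussianReal_of_var_ne_zero _ one_ne_zero,
    integrable_withDensity_iff_integrable_smul' (measurable_gaussianPDF _ _)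
      (ae_of_all _ fun x => by simp [gaussianPDF])] at h
  simpa [gaussianPDF, ENNReal.toReal_ofReal (gaussianPDFReal_nonneg _ _ _)] using h

lemma gq_hasDerivAt_pdf (x : ℝ) :
    HasDerivAt (gaussianPDFReal 0 1) (-x * gaussianPDFReal 0 1 x) x := by
  have h : HasDerivAt (fun x : ℝ => -(x - 0) ^ 2 / (2 * ((1 : NNReal) : ℝ))) (-x) x := by
    have h1 := (((hasDerivAt_id x).sub_const 0).pow 2).neg.div_const (2 * ((1 : NNReal) : ℝ))
    refine h1.congr_deriv ?_
    simp; ring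
  have := (h.exp).const_mul ((√(2 * Real.pi * ((1 : NNReal) : ℝ)))⁻¹)
  rw [gaussianPDFReal_def]
  refine this.congr_deriv ?_
  ring

lemma gq_moment_rec (n : ℕ) :
    ∫ x, x ^ (n + 2) ∂(gaussianReal 0 1) = (n + 1) * ∫ x, x ^ n ∂(gaussianReal 0 1) := by
  simp only [integral_gaussianReal_eq_integral_smul (one_ne_zero), smul_eq_mul]
  have hd : ∀ x : ℝ, HasDerivAt (fun x : ℝ => gaussianPDFReal 0 1 x * x ^ (n + 1))
      ((n + 1) * (gaussianPDFReal 0 1 x * x ^ n) - gaussianPDFReal 0 1 x * x ^ (n + 2)) x := by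
    intro x
    refine ((gq_hasDerivAt_pdf x).mul (hasDerivAt_pow (n + 1) x)).congr_deriv ?_
    push_cast
    ring
  have i1 := (gq_integrable_pow_pdf n).const_mul ((n : ℝ) + 1)
  have i2 := gq_integrable_pow_pdf (n + 2)
  have := integral_eq_zero_of_hasDerivAt_of_integrable hd (i1.sub i2) (gq_integrable_pow_pdf (n + 1))
  rw [integral_sub i1 i2, integral_const_mul] at this
  linarith

lemma gq_moments : ∫ x, x ^ 2 ∂(gaussianReal 0 1) = 1 ∧ ∫ x, x ^ 4 ∂(gaussianReal 0 1) = 3 ∧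
    ∫ x, x ^ 6 ∂(gaussianReal 0 1) = 15 ∧ ∫ x, x ^ 8 ∂(gaussianReal 0 1) = 105 := by
  have h0 := gq_moment_rec 0
  have h2 := gq_moment_rec 2
  have h4 := gq_moment_rec 4
  have h6 := gq_moment_rec 6
  norm_num at h0 h2 h4 h6
  rw [h0] at h2
  rw [h2] at h4
  rw [h4] at h6
  refine ⟨h0, ?_, ?_, ?_⟩ <;> linarith

/-- Moment bounds for a weighted sum of squares of independent standard Gaussians. -/
lemma gq_diag (s : ℝ) : ∀ (n : ℕ) (l : Fin n → ℝ), (∀ i, 0 ≤ l i) → (∀ i, l i ≤ s) →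
    (∀ k : ℕ, Integrable (fun x : Fin n → ℝ => (∑ i, l i * x i ^ 2) ^ k)
      (Measure.pi fun _ => gaussianReal 0 1)) ∧
    (∫ x, (∑ i, l i * x i ^ 2) ^ 1 ∂(Measure.pi fun _ : Fin n => gaussianReal 0 1) ≤ ∑ i, l i) ∧
    (∫ x, (∑ i, l i * x i ^ 2) ^ 2 ∂(Measure.pi fun _ : Fin n => gaussianReal 0 1)
      ≤ (∑ i, l i) * ((∑ i, l i) + 2 * s)) ∧
    (∫ x, (∑ i, l i * x i ^ 2) ^ 3 ∂(Measure.pi fun _ : Fin n => gaussianReal 0 1)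
      ≤ (∑ i, l i) * ((∑ i, l i) + 2 * s) * ((∑ i, l i) + 4 * s)) ∧
    (∫ x, (∑ i, l i * x i ^ 2) ^ 4 ∂(Measure.pi fun _ : Fin n => gaussianReal 0 1)
      ≤ (∑ i, l i) * ((∑ i, l i) + 2 * s) * ((∑ i, l i) + 4 * s) * ((∑ i, l i) + 6 * s)) := by
  intro n
  induction n with
  | zero => intro l _ _; simp
  | succ n ih =>
    intro l hl hs
    obtain ⟨hI, h1, h2, h3, h4⟩ := ih (fun i => l i.succ) (fun i => hl _) (fun i => hs _)
    have hmp := measurePreserving_piFinSuccAbove (fun _ : Fin (n + 1) => gaussianReal 0 1) 0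
    set ν := Measure.pi fun _ : Fin n => gaussianReal 0 1 with hν
    set Q : (Fin n → ℝ) → ℝ := fun x => ∑ i, l i.succ * x i ^ 2 with hQ
    have key : ∀ k : ℕ, (fun x : Fin (n + 1) → ℝ => (∑ i, l i * x i ^ 2) ^ k) =
        (fun y : ℝ × (Fin n → ℝ) => (l 0 * y.1 ^ 2 + Q y.2) ^ k) ∘
          (MeasurableEquiv.piFinSuccAbove (fun _ : Fin (n + 1) => ℝ) 0) := by
      intro k
      funext x
      simp [Fin.sum_univ_succ, hQ, MeasurableEquiv.piFinSuccAbove, Fin.tail]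
    have iterm : ∀ (a b : ℕ) (c : ℝ), Integrable
        (fun y : ℝ × (Fin n → ℝ) => c * (y.1 ^ a * Q y.2 ^ b)) ((gaussianReal 0 1).prod ν) :=
      fun a b c => ((gq_integrable_pow a).mul_prod (hI b)).const_mul c
    have vterm : ∀ (a b : ℕ) (c : ℝ), ∫ y : ℝ × (Fin n → ℝ), c * (y.1 ^ a * Q y.2 ^ b)
        ∂((gaussianReal 0 1).prod ν) = c * ((∫ x, x ^ a ∂(gaussianReal 0 1)) * ∫ x, Q x ^ b ∂ν) :=
      fun a b c => by rw [integral_const_mul, integral_prod_mul (fun x : ℝ => x ^ a) (fun x => Q x ^ b)]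
    have expand : ∀ k : ℕ, (fun y : ℝ × (Fin n → ℝ) => (l 0 * y.1 ^ 2 + Q y.2) ^ k) =
        fun y => ∑ j ∈ Finset.range (k + 1),
          (l 0 ^ j * (k.choose j : ℝ)) * (y.1 ^ (2 * j) * Q y.2 ^ (k - j)) := by
      intro k
      funext y
      rw [add_pow]
      refine Finset.sum_congr rfl fun j _ => ?_
      rw [mul_pow, ← pow_mul]
      ring
    have hInt : ∀ k : ℕ, Integrable (fun y : ℝ × (Fin n → ℝ) => (l 0 * y.1 ^ 2 + Q y.2) ^ k)
        ((gaussianReal 0 1).prod ν) := by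
      intro k
      rw [expand k]
      exact integrable_finsetSum _ fun j _ => iterm _ _ _
    have hval : ∀ k : ℕ, ∫ x, (∑ i, l i * x i ^ 2) ^ k
          ∂(Measure.pi fun _ : Fin (n + 1) => gaussianReal 0 1) =
        ∑ j ∈ Finset.range (k + 1), (l 0 ^ j * (k.choose j : ℝ)) *
          ((∫ x, x ^ (2 * j) ∂(gaussianReal 0 1)) * ∫ x, Q x ^ (k - j) ∂ν) := by
      intro k
      rw [key k]
      have := hmp.integral_comp' (fun y : ℝ × (Fin n → ℝ) => (l 0 * y.1 ^ 2 + Q y.2) ^ k)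
      refine this.trans ?_
      rw [expand k, integral_finsetSum _ fun j _ => iterm _ _ _]
      exact Finset.sum_congr rfl fun j _ => vterm _ _ _
    obtain ⟨m2, m4, m6, m8⟩ := gq_moments
    have hT : 0 ≤ ∑ i : Fin n, l i.succ := Finset.sum_nonneg fun i _ => hl _
    have ha := hl 0
    have has := hs 0
    have hs0 : 0 ≤ s := ha.trans has
    refine ⟨fun k => ?_, ?_, ?_, ?_, ?_⟩
    · rw [key k]
      exact hmp.integrable_comp_of_integrable (hInt k)
    all_goals
      rw [hval, Fin.sum_univ_succ]
      simp only [Finset.sum_range_succ, Finset.sum_range_zero]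
      norm_num [Nat.choose, m2, m4, m6, m8]
      simp only [pow_one] at h1
      generalize (∑ i : Fin n, l i.succ) = T at *
      generalize l 0 = a at *
      generalize (∫ x, Q x ∂ν) = q1 at *
      generalize (∫ x, Q x ^ 2 ∂ν) = q2 at *
      generalize (∫ x, Q x ^ 3 ∂ν) = q3 at *
      generalize (∫ x, Q x ^ 4 ∂ν) = q4 at *
    · linarith
    · have e1 := mul_le_mul_of_nonneg_left h1 ha
      have f2 : 0 ≤ a * (s - a) := mul_nonneg ha (sub_nonneg.2 has)
      nlinarith
    · have e1 := mul_le_mul_of_nonneg_left h1 (pow_nonneg ha 2)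
      have e2 := mul_le_mul_of_nonneg_left h2 ha
      have b2 : 3 * a ^ 2 ≤ a * (a + 2 * s) := by nlinarith
      have b3 : 15 * a ^ 3 ≤ a * (a + 2 * s) * (a + 4 * s) := by
        have : 3 * a ^ 2 * (5 * a) ≤ a * (a + 2 * s) * (a + 4 * s) :=
          mul_le_mul b2 (by linarith) (by positivity) (by positivity)
        linarith
      have g2 := mul_le_mul_of_nonneg_right b2 hT
      nlinarith
    · have e1 := mul_le_mul_of_nonneg_left h1 (pow_nonneg ha 3)
      have e2 := mul_le_mul_of_nonneg_left h2 (pow_nonneg ha 2)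
      have e3 := mul_le_mul_of_nonneg_left h3 ha
      have b2 : 3 * a ^ 2 ≤ a * (a + 2 * s) := by nlinarith
      have b3 : 15 * a ^ 3 ≤ a * (a + 2 * s) * (a + 4 * s) := by
        have : 3 * a ^ 2 * (5 * a) ≤ a * (a + 2 * s) * (a + 4 * s) :=
          mul_le_mul b2 (by linarith) (by positivity) (by positivity)
        linarith
      have b4 : 105 * a ^ 4 ≤ a * (a + 2 * s) * (a + 4 * s) * (a + 6 * s) := by
        have : 15 * a ^ 3 * (7 * a) ≤ a * (a + 2 * s) * (a + 4 * s) * (a + 6 * s) :=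
          mul_le_mul b3 (by linarith) (by positivity) (by positivity)
        linarith
      have g3 := mul_le_mul_of_nonneg_right b3 hT
      have g2 := mul_le_mul_of_nonneg_right b2 (show 0 ≤ T * (T + 2 * s) by positivity)
      nlinarith

lemma gq_bdd {p : ℕ} (M : Matrix (Fin p) (Fin p) ℝ) :
    BddAbove {c | ∃ u v : Fin p → ℝ, (∑ i, (u i) ^ 2) = 1 ∧ (∑ i, (v i) ^ 2) = 1 ∧
      c = |u ⬝ᵥ M.mulVec v|} := by
  refine ⟨∑ i, ∑ j, |M i j|, ?_⟩
  rintro c ⟨u, v, hu, hv, rfl⟩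
  have aux : ∀ w : Fin p → ℝ, (∑ i, (w i) ^ 2) = 1 → ∀ i, |w i| ≤ 1 := by
    intro w hw i
    rw [← sq_le_one_iff_abs_le_one, ← hw]
    exact Finset.single_le_sum (f := fun i => w i ^ 2) (fun i _ => sq_nonneg _) (Finset.mem_univ i)
  simp only [dotProduct, Matrix.mulVec, Finset.mul_sum]
  refine (Finset.abs_sum_le_sum_abs _ _).trans (Finset.sum_le_sum fun i _ => ?_)
  refine (Finset.abs_sum_le_sum_abs _ _).trans (Finset.sum_le_sum fun j _ => ?_)
  rw [abs_mul, abs_mul]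
  have h1 := aux u hu i
  have h2 := aux v hv j
  calc |u i| * (|M i j| * |v j|) ≤ 1 * (|M i j| * 1) := by gcongr
    _ = |M i j| := by ring

lemma gq_eig_le {p : ℕ} (A : Matrix (Fin p) (Fin p) ℝ) (hA : A.IsHermitian) (i : Fin p) :
    hA.eigenvalues i ≤ specNorm A := by
  have hn : (∑ j, (hA.eigenvectorBasis i j) ^ 2) = 1 := by
    rw [← EuclideanSpace.real_norm_sq_eq, hA.eigenvectorBasis.orthonormal.1 i, one_pow]
  have : |hA.eigenvalues i| ≤ specNorm A := by
    refine le_csSup (gq_bdd A) ⟨hA.eigenvectorBasis i, hA.eigenvectorBasis i, hn, hn, ?_⟩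
    rw [hA.mulVec_eigenvectorBasis, dotProduct_smul]
    have : (⇑(hA.eigenvectorBasis i) ⬝ᵥ ⇑(hA.eigenvectorBasis i)) = 1 := by
      rw [← hn]; simp [dotProduct, sq]
    rw [this]; simp
  exact (le_abs_self _).trans this

lemma gq_quad {p : ℕ} (A : Matrix (Fin p) (Fin p) ℝ) (hA : A.IsHermitian) (x : Fin p → ℝ) :
    (A.mulVec (WithLp.ofLp (∑ i, x i • hA.eigenvectorBasis i))) ⬝ᵥ
      (WithLp.ofLp (∑ i, x i • hA.eigenvectorBasis i)) = ∑ i, hA.eigenvalues i * x i ^ 2 := by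
  have ho : ∀ i j, ((hA.eigenvectorBasis i).ofLp ⬝ᵥ (hA.eigenvectorBasis j).ofLp)
      = if i = j then 1 else 0 := by
    intro i j
    have := (orthonormal_iff_ite.1 hA.eigenvectorBasis.orthonormal) j i
    rw [EuclideanSpace.inner_eq_star_dotProduct] at this
    simpa [eq_comm] using this
  simp only [WithLp.ofLp_sum, WithLp.ofLp_smul, Matrix.mulVec_sum, Matrix.mulVec_smul,
    hA.mulVec_eigenvectorBasis, sum_dotProduct, dotProduct_sum, smul_dotProduct, dotProduct_smul, ho]
  simp
  refine Finset.sum_congr rfl fun i _ => ?_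
  ring

lemma gq_rotate {p : ℕ} (b : OrthonormalBasis (Fin p) ℝ (EuclideanSpace ℝ (Fin p)))
    (F : (Fin p → ℝ) → ℝ) (hF : Continuous F) :
    ∫ z, F z ∂(Measure.pi fun _ : Fin p => gaussianReal 0 1) =
    ∫ x, F (WithLp.ofLp (∑ i, x i • b i)) ∂(Measure.pi fun _ : Fin p => gaussianReal 0 1) := by
  have h1 := map_pi_eq_stdGaussian (ι := Fin p)
  rw [stdGaussian_eq_map_pi_orthonormalBasis b] at h1
  have hc : Continuous fun y : EuclideanSpace ℝ (Fin p) => F (WithLp.ofLp y) := by fun_prop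
  have h2 := congrArg (fun m => ∫ y : EuclideanSpace ℝ (Fin p), F (WithLp.ofLp y) ∂m) h1
  simp only at h2
  have hm : Continuous fun x : Fin p → ℝ => ∑ i, x i • b i := by fun_prop
  rw [integral_map hm.measurable.aemeasurable hc.aestronglyMeasurable,
    integral_map (by fun_prop) hc.aestronglyMeasurable] at h2
  exact h2

/-- Fourth-moment bound for Gaussian quadratic forms: for `Z ~ N(0, I_p)` and `A`
positive definite, `E[⟨AZ, Z⟩⁴] ≤ (tr(A) + 3 ‖A‖₂)⁴`. -/
theorem gaussian_quadratic_fourth_moment {p : ℕ} (A : Matrix (Fin p) (Fin p) ℝ)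
    (hA : A.PosDef) :
    (∫ z, ((A.mulVec z) ⬝ᵥ z) ^ 4 ∂stdGaussian p)
      ≤ (A.trace + 3 * specNorm A) ^ 4 := by
  have hH := hA.isHermitian
  have htr : A.trace = ∑ i, hH.eigenvalues i := by simpa using hH.trace_eq_sum_eigenvalues
  have hpos : ∀ i, 0 ≤ hH.eigenvalues i := fun i => (hA.eigenvalues_pos i).le
  have hs : 0 ≤ specNorm A := by
    refine Real.sSup_nonneg ?_
    rintro c ⟨u, v, _, _, rfl⟩
    exact abs_nonneg _
  have hT : 0 ≤ ∑ i, hH.eigenvalues i := Finset.sum_nonneg fun i _ => hpos i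
  obtain ⟨-, -, -, -, h4⟩ := gq_diag (specNorm A) p hH.eigenvalues hpos (gq_eig_le A hH)
  have hrot := gq_rotate hH.eigenvectorBasis (fun z => ((A.mulVec z) ⬝ᵥ z) ^ 4)
    (by simp only [dotProduct, Matrix.mulVec]; fun_prop)
  simp only [gq_quad] at hrot
  rw [htr]
  refine (hrot.le.trans h4).trans ?_
  generalize (∑ i, hH.eigenvalues i) = T at *
  generalize specNorm A = s at *
  have e : (T + 3 * s) ^ 4 - T * (T + 2 * s) * (T + 4 * s) * (T + 6 * s) =
    10 * (s ^ 2 * T ^ 2) + 60 * (s ^ 3 * T) + 81 * s ^ 4 := by ring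
  have : 0 ≤ 10 * (s ^ 2 * T ^ 2) + 60 * (s ^ 3 * T) + 81 * s ^ 4 := by positivity
  linarith
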